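/- Let T be a θ-type Calderón–Zygmund operator on ℝⁿ with kernel K, where θ satisfies the Dini condition. For j ∈ ℤ set T_j f(x) = ∫_{|x−y|>2^j} K(x,y) f(y) dy. Then for every γ ∈ (0,1] there is a constant C such that for every f ∈ C_c^∞(ℝⁿ) and almost every x ∈ ℝⁿ: sup_{j∈ℤ} |T_j f(x)| ≤ C ( (M(|Tf|^γ)(x))^{1/γ} + Mf(x) ). -/

import Mathlib

open MeasureTheory Metric Filter Set
open scoped ENNReal Topology

noncomputable section

abbrev Rn (n : ℕ) := EuclideanSpace ℝ (Fin n)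

/-- θ is a modulus of continuity as in the paper: continuous, increasing,
subadditive on `[0,1]`, nonnegative, with `θ 0 = 0`. -/
def IsModulus (θ : ℝ → ℝ) : Prop :=
  ContinuousOn θ (Icc 0 1) ∧ MonotoneOn θ (Icc 0 1) ∧
    (∀ s t : ℝ, 0 ≤ s → 0 ≤ t → s + t ≤ 1 → θ (s + t) ≤ θ s + θ t) ∧
    θ 0 = 0 ∧ ∀ t ∈ Icc (0:ℝ) 1, 0 ≤ θ t

/-- The Dini condition `∫₀¹ θ(t)/t dt < ∞`. -/
def DiniCondition (θ : ℝ → ℝ) : Prop :=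
  IntegrableOn (fun t => θ t / t) (Ioc (0:ℝ) 1)

/-- `K` is a θ-type kernel with size constant `C₀`. -/
def IsThetaKernel (n : ℕ) (θ : ℝ → ℝ) (C₀ : ℝ) (K : Rn n → Rn n → ℝ) : Prop :=
  (∀ x y : Rn n, x ≠ y → |K x y| ≤ C₀ / ‖x - y‖ ^ n) ∧
    ∀ x x' y : Rn n, x ≠ y → 2 * ‖x - x'‖ ≤ ‖x - y‖ →
      |K x y - K x' y| + |K y x - K y x'| ≤ θ (‖x - x'‖ / ‖x - y‖) / ‖x - y‖ ^ n

/-- The open cube centered at `c` with sidelength `r`. -/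
def cube {n : ℕ} (c : Rn n) (r : ℝ) : Set (Rn n) := {x | ∀ i, |x i - c i| < r / 2}

/-- `ω` is a Muckenhoupt `A_p` weight (over cubes). -/
def IsAp (n : ℕ) (p : ℝ) (ω : Rn n → ℝ) : Prop :=
  (∀ᵐ x : Rn n, 0 < ω x) ∧ LocallyIntegrable ω volume ∧
    ∃ A : ℝ≥0∞, A ≠ ⊤ ∧ ∀ (c : Rn n) (r : ℝ), 0 < r →
      ((∫⁻ x in cube c r, ENNReal.ofReal (ω x)) / ENNReal.ofReal (r ^ n)) *
        (((∫⁻ x in cube c r, ENNReal.ofReal (ω x ^ (1 - p / (p - 1)))) /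
          ENNReal.ofReal (r ^ n)) ^ (p - 1)) ≤ A

/-- The measure `ω(x) dx`. -/
def wMeasure (n : ℕ) (ω : Rn n → ℝ) : Measure (Rn n) :=
  (volume : Measure (Rn n)).withDensity fun x => ENNReal.ofReal (ω x)

/-- Hardy–Littlewood maximal function, `ℝ≥0∞`-valued. -/
def maximal {n : ℕ} (f : Rn n → ℝ) (x : Rn n) : ℝ≥0∞ :=
  ⨆ (r : ℝ) (_ : 0 < r),
    (volume (ball x r))⁻¹ * ∫⁻ y in ball x r, ENNReal.ofReal |f y|

/-- Mean oscillation of `b` over the ball `B(c,r)`. -/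
def oscBall {n : ℕ} (b : Rn n → ℝ) (c : Rn n) (r : ℝ) : ℝ :=
  ⨍ x in ball c r, |b x - ⨍ y in ball c r, b y|

/-- `b ∈ BMO(ℝⁿ)`. -/
def IsBMO {n : ℕ} (b : Rn n → ℝ) : Prop :=
  LocallyIntegrable b volume ∧ ∃ C : ℝ, ∀ c r, 0 < r → oscBall b c r ≤ C

/-- The BMO norm of `b`. -/
def bmoNorm {n : ℕ} (b : Rn n → ℝ) : ℝ :=
  ⨆ c : Rn n, ⨆ r : {r : ℝ // 0 < r}, oscBall b c r.1

/-- `b ∈ VMO(ℝⁿ)`: `b ∈ BMO` and its oscillation over balls of a fixed size tends to `0`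
both as the size tends to `0` and as it tends to `∞`. -/
def IsVMO {n : ℕ} (b : Rn n → ℝ) : Prop :=
  IsBMO b ∧
    Tendsto (fun r : ℝ => ⨆ c : Rn n, oscBall b c r) (𝓝[>] 0) (𝓝 0) ∧
    Tendsto (fun r : ℝ => ⨆ c : Rn n, oscBall b c r) atTop (𝓝 0)

/-- `T` is an operator, bounded on `L²`, associated with the kernel `K`:
for smooth compactly supported `f` and a.e. `x` outside the support of `f`,
`T f x = ∫ K x y * f y dy`. -/
def IsCZO (n : ℕ) (K : Rn n → Rn n → ℝ)
    (T : Lp ℝ 2 (volume : Measure (Rn n)) →L[ℝ] Lp ℝ 2 (volume : Measure (Rn n))) : Prop :=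
  ∀ (f : Rn n → ℝ) (hf : MemLp f 2 (volume : Measure (Rn n))),
    ContDiff ℝ (⊤ : ℕ∞) f → HasCompactSupport f →
      ∀ᵐ x : Rn n, x ∉ tsupport f → (T (hf.toLp f) : Rn n → ℝ) x = ∫ y, K x y * f y

/-- Properties of the smooth truncation function `ψ`. -/
def PsiCond (ψ : ℝ → ℝ) (C₁ : ℝ) : Prop :=
  (∀ t, 0 ≤ ψ t ∧ ψ t ≤ 1) ∧ (∀ t ≤ (1:ℝ)/2, ψ t = 0) ∧ (∀ t, 1 ≤ t → ψ t = 1) ∧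
    ∀ t ∈ Ioo ((1:ℝ)/2) 1, |deriv ψ t| ≤ C₁

/-- The maximal commutator `[b,T*] f (x)`. -/
def maxComm {n : ℕ} (K : Rn n → Rn n → ℝ) (b f : Rn n → ℝ) (x : Rn n) : ℝ≥0∞ :=
  ⨆ (ε : ℝ) (_ : 0 < ε),
    ENNReal.ofReal |∫ y in {y : Rn n | ε ≤ dist x y}, (b x - b y) * K x y * f y|

/-- The maximal truncated singular integral `T* f (x)`. -/
def truncT {n : ℕ} (K : Rn n → Rn n → ℝ) (f : Rn n → ℝ) (x : Rn n) : ℝ≥0∞ :=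
  ⨆ (ε : ℝ) (_ : 0 < ε),
    ENNReal.ofReal |∫ y in {y : Rn n | ε ≤ dist x y}, K x y * f y|

/-- Weighted `L^p` "norm" of an `ℝ≥0∞`-valued function. -/
def wLpNorm {n : ℕ} (p : ℝ) (μ : Measure (Rn n)) (g : Rn n → ℝ≥0∞) : ℝ≥0∞ :=
  (∫⁻ x, g x ^ p ∂μ) ^ (1 / p)

/-- `‖∇b‖_∞`. -/
def gradSup {n : ℕ} (b : Rn n → ℝ) : ℝ := ⨆ x : Rn n, ‖fderiv ℝ b x‖

/-- The maximal operator `M_b`. -/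
def Mb {n : ℕ} (b f : Rn n → ℝ) (x : Rn n) : ℝ≥0∞ :=
  ⨆ (r : ℝ) (_ : 0 < r),
    (ENNReal.ofReal (r ^ n))⁻¹ * ∫⁻ y in ball x r, ENNReal.ofReal (|b x - b y| * |f y|)


def diniSum (θ : ℝ → ℝ) : ℝ≥0∞ := ∑' k : ℕ, ENNReal.ofReal (θ ((1/2:ℝ)^(k+1)))

lemma half_pow_mem (k : ℕ) : ((1/2:ℝ)^k) ∈ Icc (0:ℝ) 1 :=
  ⟨by positivity, pow_le_one₀ (by norm_num) (by norm_num)⟩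

lemma diniSum_ne_top {θ : ℝ → ℝ} (hθ : IsModulus θ) (hD : DiniCondition θ) :
    diniSum θ ≠ ⊤ := by
  obtain ⟨hc, hm, hs, h0, hp⟩ := hθ
  have hfin : ∫⁻ t in Ioc (0:ℝ) 1, ENNReal.ofReal (θ t / t) ≠ ⊤ := by
    have h1 := hD.2
    have h2 : ∫⁻ t in Ioc (0:ℝ) 1, ENNReal.ofReal (θ t / t) ≤ ∫⁻ t in Ioc (0:ℝ) 1, ‖θ t / t‖ₑ := by
      apply lintegral_mono
      intro t
      exact Real.ofReal_le_enorm _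
    exact (lt_of_le_of_lt h2 h1).ne
  have key : ∀ k : ℕ, ENNReal.ofReal (θ ((1/2:ℝ)^(k+1))) ≤
      2 * ∫⁻ t in Ioc ((1/2:ℝ)^(k+1)) ((1/2:ℝ)^k), ENNReal.ofReal (θ t / t) := by
    intro k
    set a := (1/2:ℝ)^(k+1) with ha
    have hak : (1/2:ℝ)^k = 2 * a := by rw [ha, pow_succ]; ring
    have hapos : 0 < a := by positivity
    have hle : ∫⁻ t in Ioc a ((1/2:ℝ)^k), ENNReal.ofReal (θ a / (2*a)) ≤
        ∫⁻ t in Ioc a ((1/2:ℝ)^k), ENNReal.ofReal (θ t / t) := by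
      apply setLIntegral_mono' measurableSet_Ioc
      intro t ht
      apply ENNReal.ofReal_le_ofReal
      have ht1 : t ∈ Icc (0:ℝ) 1 := ⟨by linarith [ht.1], ht.2.trans (half_pow_mem k).2⟩
      have hθle : θ a ≤ θ t := hm (half_pow_mem (k+1)) ht1 ht.1.le
      have : 0 ≤ θ a := hp a (half_pow_mem (k+1))
      rw [hak] at ht
      have htpos : 0 < t := by linarith [ht.1]
      exact div_le_div₀ (by linarith) hθle htpos ht.2
    rw [setLIntegral_const, Real.volume_Ioc, ← ENNReal.ofReal_mul
      (div_nonneg (hp a (half_pow_mem (k+1))) (by positivity))] at hle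
    calc _ = 2 * ENNReal.ofReal (θ a / (2*a) * ((1/2:ℝ)^k - a)) := by
          rw [hak, show (2:ℝ≥0∞) = ENNReal.ofReal 2 by simp, ← ENNReal.ofReal_mul (by norm_num)]
          congr 1; field_simp; ring
      _ ≤ _ := by gcongr
  have hsum : diniSum θ ≤ 2 * ∫⁻ t in Ioc (0:ℝ) 1, ENNReal.ofReal (θ t / t) := by
    calc diniSum θ ≤ ∑' k : ℕ, 2 * ∫⁻ t in Ioc ((1/2:ℝ)^(k+1)) ((1/2:ℝ)^k), ENNReal.ofReal (θ t / t) :=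
          ENNReal.tsum_le_tsum key
      _ = 2 * ∑' k : ℕ, ∫⁻ t in Ioc ((1/2:ℝ)^(k+1)) ((1/2:ℝ)^k), ENNReal.ofReal (θ t / t) :=
          ENNReal.tsum_mul_left
      _ = 2 * ∫⁻ t in ⋃ k : ℕ, Ioc ((1/2:ℝ)^(k+1)) ((1/2:ℝ)^k), ENNReal.ofReal (θ t / t) := by
          rw [lintegral_iUnion (fun _ => measurableSet_Ioc)]
          have hanti : Antitone (fun k : ℕ => (1/2:ℝ)^k) :=
            fun a b h => pow_le_pow_of_le_one (by norm_num) (by norm_num) h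
          have := hanti.pairwise_disjoint_on_Ioc_succ
          exact this
      _ ≤ _ := by
          gcongr
          apply iUnion_subset
          intro k t ht
          exact ⟨lt_trans (by positivity) ht.1, ht.2.trans (half_pow_mem k).2⟩
  exact (lt_of_le_of_lt hsum (ENNReal.mul_lt_top (by simp) hfin.lt_top)).ne

lemma annuli {n : ℕ} {θ : ℝ → ℝ} (hθ : IsModulus θ) (h : Rn n → ℝ≥0∞) (c : Rn n) (δ : ℝ)
    (hδ : 0 < δ) (H : ℝ≥0∞)
    (hH : ∀ R : ℝ, 0 < R → ∫⁻ y in ball c R, h y ≤ H * ENNReal.ofReal (R ^ n)) :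
    ∫⁻ y in {y : Rn n | 2 * δ ≤ dist c y}, ENNReal.ofReal (θ (δ / dist c y) / dist c y ^ n) * h y
      ≤ diniSum θ * (H * ENNReal.ofReal (2 ^ n)) := by
  obtain ⟨hc, hm, hs, h0, hp⟩ := hθ
  set A : ℕ → Set (Rn n) := fun k => {y | 2^(k+1) * δ ≤ dist c y ∧ dist c y < 2^(k+2)*δ} with hA
  have hAm : ∀ k, MeasurableSet (A k) := by
    intro k
    have hd : Measurable (fun y : Rn n => dist c y) := by fun_prop
    exact (measurableSet_le measurable_const hd).inter
      (measurableSet_lt hd measurable_const)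
  have hsub : {y : Rn n | 2 * δ ≤ dist c y} ⊆ ⋃ k, A k := by
    intro y hy
    change 2 * δ ≤ dist c y at hy
    obtain ⟨k, hk1, hk2⟩ := exists_nat_pow_near (x := dist c y / (2*δ)) (y := (2:ℝ))
      (by rw [le_div_iff₀ (by positivity)]; linarith) (by norm_num)
    rw [le_div_iff₀ (by positivity)] at hk1
    rw [div_lt_iff₀ (by positivity)] at hk2
    refine mem_iUnion.2 ⟨k, ?_, ?_⟩
    · rw [pow_succ]; linarith
    · rw [pow_succ]; linarith
  calc _ ≤ ∫⁻ y in ⋃ k, A k, ENNReal.ofReal (θ (δ / dist c y) / dist c y ^ n) * h y :=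
        lintegral_mono_set hsub
    _ ≤ ∑' k, ∫⁻ y in A k, ENNReal.ofReal (θ (δ / dist c y) / dist c y ^ n) * h y :=
        lintegral_iUnion_le _ _
    _ ≤ ∑' k : ℕ, ENNReal.ofReal (θ ((1/2:ℝ)^(k+1))) * (H * ENNReal.ofReal (2 ^ n)) := by
        apply ENNReal.tsum_le_tsum
        intro k
        have hpos : 0 < (2:ℝ)^(k+1) * δ := by positivity
        have hθn := hp _ (half_pow_mem (k+1))
        calc _ ≤ ∫⁻ y in A k, ENNReal.ofReal (θ ((1/2:ℝ)^(k+1)) / (2^(k+1) * δ)^n) * h y := by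
              apply setLIntegral_mono' (hAm k)
              intro y hy
              gcongr
              · have hd : 0 < dist c y := lt_of_lt_of_le hpos hy.1
                have h1 : δ / dist c y ≤ (1/2:ℝ)^(k+1) := by
                  rw [div_le_iff₀ hd, one_div_pow, div_mul_eq_mul_div, le_div_iff₀ (by positivity)]
                  linarith [hy.1]
                exact hm ⟨by positivity, h1.trans (half_pow_mem (k+1)).2⟩ (half_pow_mem (k+1)) h1
              · exact hy.1
          _ = ENNReal.ofReal (θ ((1/2:ℝ)^(k+1)) / (2^(k+1) * δ)^n) * ∫⁻ y in A k, h y :=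
              lintegral_const_mul' _ _ ENNReal.ofReal_ne_top
          _ ≤ ENNReal.ofReal (θ ((1/2:ℝ)^(k+1)) / (2^(k+1) * δ)^n) *
                (H * ENNReal.ofReal ((2^(k+2)*δ) ^ n)) := by
              gcongr
              refine le_trans (lintegral_mono_set ?_) (hH _ (by positivity))
              intro y hy
              rw [mem_ball']
              exact hy.2
          _ = _ := by
              rw [mul_left_comm, mul_left_comm (ENNReal.ofReal (θ _)), ← ENNReal.ofReal_mul (by positivity),
                ← ENNReal.ofReal_mul (by positivity)]
              congr 2
              rw [show (2:ℝ)^(k+2)*δ = 2 * (2^(k+1)*δ) by ring, mul_pow 2]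
              field_simp
    _ = _ := ENNReal.tsum_mul_right


lemma kernel_contAt {n : ℕ} {θ : ℝ → ℝ} (hθ : IsModulus θ) {C₀ : ℝ} {K : Rn n → Rn n → ℝ}
    (hK : IsThetaKernel n θ C₀ K) (z y : Rn n) (hyz : y ≠ z) : ContinuousAt (K z) y := by
  obtain ⟨hc, hm, hs, h0, hp⟩ := hθ
  have hpos : 0 < ‖y - z‖ := norm_pos_iff.2 (sub_ne_zero.2 hyz)
  have hev : ∀ᶠ x' in 𝓝 y, 2 * ‖y - x'‖ < ‖y - z‖ := by
    have : ContinuousAt (fun x' => 2 * ‖y - x'‖) y := by fun_prop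
    exact this.eventually_lt continuousAt_const (by simpa using hpos)
  have hbound : ∀ᶠ x' in 𝓝 y, dist (K z x') (K z y) ≤ θ (‖y - x'‖ / ‖y - z‖) / ‖y - z‖ ^ n := by
    filter_upwards [hev] with x' hx'
    have := hK.2 y x' z hyz hx'.le
    rw [Real.dist_eq, abs_sub_comm]
    linarith [abs_nonneg (K y z - K x' z)]
  have hlim : Tendsto (fun x' => θ (‖y - x'‖ / ‖y - z‖) / ‖y - z‖ ^ n) (𝓝 y) (𝓝 0) := by
    have h1 : Tendsto (fun x' => ‖y - x'‖ / ‖y - z‖) (𝓝 y) (𝓝[Icc 0 1] 0) := by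
      apply tendsto_nhdsWithin_iff.2
      constructor
      · have : ContinuousAt (fun x' => ‖y - x'‖ / ‖y - z‖) y := by fun_prop
        simpa [ContinuousAt] using this
      · filter_upwards [hev] with x' hx'
        refine ⟨by positivity, ?_⟩
        rw [div_le_one hpos]
        linarith [norm_nonneg (y - x')]
    have h2 := (hc 0 (by simp)).tendsto.comp h1
    rw [h0] at h2
    simpa using h2.div_const (‖y - z‖ ^ n)
  rw [ContinuousAt, tendsto_iff_dist_tendsto_zero]
  exact squeeze_zero' (Eventually.of_forall fun _ => dist_nonneg) hbound hlim

lemma kernel_contOn {n : ℕ} {θ : ℝ → ℝ} (hθ : IsModulus θ) {C₀ : ℝ} {K : Rn n → Rn n → ℝ}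
    (hK : IsThetaKernel n θ C₀ K) (z : Rn n) (s : Set (Rn n)) (hs : z ∉ s) :
    ContinuousOn (K z) s := fun y hy =>
  (kernel_contAt hθ hK z y (fun h => hs (h ▸ hy))).continuousWithinAt

lemma kernel_bound {n : ℕ} {θ : ℝ → ℝ} {C₀ : ℝ} {K : Rn n → Rn n → ℝ}
    (hK : IsThetaKernel n θ C₀ K) (z y : Rn n) (r : ℝ) (hr : 0 < r) (h : r ≤ dist z y) :
    |K z y| ≤ |C₀| / r ^ n := by
  have hne : z ≠ y := by rintro rfl; simp at h; linarith
  rw [dist_eq_norm] at h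
  refine (hK.1 z y hne).trans ?_
  gcongr
  exact le_abs_self _

lemma czo_ext {n : ℕ} {θ : ℝ → ℝ} (hθ : IsModulus θ) {C₀ : ℝ} {K : Rn n → Rn n → ℝ}
    (hK : IsThetaKernel n θ C₀ K)
    {T : Lp ℝ 2 (volume : Measure (Rn n)) →L[ℝ] Lp ℝ 2 (volume : Measure (Rn n))}
    (hT : IsCZO n K T) (g : Rn n → ℝ) (hg : MemLp g 2 (volume : Measure (Rn n)))
    (c : Rn n) (δ : ℝ) (hδ : 0 < δ) (hsupp : ∀ y, y ∉ closedBall c δ → g y = 0) :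
    ∀ᵐ z : Rn n, 2 * δ < dist c z → (T (hg.toLp g) : Rn n → ℝ) z = ∫ y, K z y * g y := by
  let χ : ContDiffBump c := ⟨δ, 3/2*δ, hδ, by linarith⟩
  have happ : ∀ k : ℕ, ∃ u : Rn n → ℝ, HasCompactSupport u ∧ ContDiff ℝ (⊤:ℕ∞) u ∧
      eLpNorm (g - u) 2 volume ≤ ENNReal.ofReal (1/((k:ℝ)+1)) := fun k =>
    MeasureTheory.MemLp.exist_eLpNorm_sub_le (by simp) (by norm_num) hg (by positivity)
  choose u hu1 hu2 hu3 using happ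
  set w : ℕ → Rn n → ℝ := fun k y => χ y * u k y with hw
  have hw1 : ∀ k, HasCompactSupport (w k) := fun k => (hu1 k).mul_left
  have hw2 : ∀ k, ContDiff ℝ (⊤:ℕ∞) (w k) := fun k => χ.contDiff.mul (hu2 k)
  have hw3 : ∀ k, MemLp (w k) 2 (volume : Measure (Rn n)) := fun k =>
    (hw2 k).continuous.memLp_of_hasCompactSupport (hw1 k)
  have hw4 : ∀ k, eLpNorm (w k - g) 2 volume ≤ ENNReal.ofReal (1/((k:ℝ)+1)) := by
    intro k
    refine le_trans (eLpNorm_mono ?_) (hu3 k)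
    intro y
    by_cases hy : y ∈ closedBall c δ
    · have : χ y = 1 := χ.one_of_mem_closedBall hy
      simp [hw, this, abs_sub_comm]
    · simp only [hw, Pi.sub_apply, hsupp y hy, sub_zero, zero_sub, norm_mul, norm_neg]
      have : ‖χ y‖ ≤ 1 := by
        rw [Real.norm_of_nonneg χ.nonneg]; exact χ.le_one
      exact mul_le_of_le_one_left (norm_nonneg _) this
  have hlim : Tendsto (fun k => (hw3 k).toLp (w k)) atTop (𝓝 (hg.toLp g)) := by
    rw [Lp.tendsto_Lp_iff_tendsto_eLpNorm'' _ hw3 _ hg]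
    have h0 : Tendsto (fun k : ℕ => ENNReal.ofReal (1/((k:ℝ)+1))) atTop (𝓝 0) := by
      have := ENNReal.tendsto_ofReal (tendsto_one_div_add_atTop_nhds_zero_nat (𝕜 := ℝ))
      simpa using this
    exact tendsto_of_tendsto_of_tendsto_of_le_of_le tendsto_const_nhds h0 (fun _ => zero_le) hw4
  have hTlim := (T.continuous.tendsto _).comp hlim
  obtain ⟨ns, hns, hae⟩ := (tendstoInMeasure_of_tendsto_Lp hTlim).exists_seq_tendsto_ae
  have hall : ∀ᵐ z : Rn n, ∀ k, z ∉ tsupport (w k) →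
      (T ((hw3 k).toLp (w k)) : Rn n → ℝ) z = ∫ y, K z y * w k y :=
    ae_all_iff.2 fun k => hT (w k) (hw3 k) (hw2 k) (hw1 k)
  filter_upwards [hae, hall] with z hz1 hz2 hz3
  set B := closedBall c (3/2*δ) with hB
  have hwsub : ∀ k, ∀ y, y ∉ B → w k y = 0 := by
    intro k y hy
    have : χ y = 0 := χ.zero_of_le_dist (by simpa [hB] using (not_le.1 (fun h => hy (mem_closedBall.2 h))).le)
    simp [hw, this]
  have hgsub : ∀ y, y ∉ B → g y = 0 := fun y hy => hsupp y fun h =>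
    hy (closedBall_subset_closedBall (by linarith) h)
  have hzn : ∀ k, z ∉ tsupport (w k) := by
    intro k hk
    have : tsupport (w k) ⊆ B := by
      apply closure_minimal _ isClosed_closedBall
      intro y hy
      by_contra h
      exact hy (hwsub k y h)
    have := this hk
    rw [hB, mem_closedBall, dist_comm] at this
    linarith
  have hzB : z ∉ B := by
    intro h
    rw [hB, mem_closedBall, dist_comm] at h
    linarith
  set κ : Rn n → ℝ := B.indicator (K z) with hκ
  have hκm : MemLp κ 2 (volume : Measure (Rn n)) := by
    rw [hκ, memLp_indicator_iff_restrict measurableSet_closedBall]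
    have : IsFiniteMeasure (volume.restrict B) :=
      ⟨by simpa using (isCompact_closedBall c (3/2*δ)).measure_lt_top⟩
    apply MemLp.of_bound ((kernel_contOn hθ hK z B hzB).aestronglyMeasurable measurableSet_closedBall)
      (|C₀| / (δ/2)^n)
    filter_upwards [ae_restrict_mem measurableSet_closedBall] with y hy
    rw [Real.norm_eq_abs]
    apply kernel_bound hK z y _ (by positivity)
    have h1 : dist y c ≤ 3/2*δ := hy
    have h2 := dist_triangle c y z
    rw [dist_comm c y, dist_comm y z] at h2
    linarith
  have hinner : ∀ (v : Rn n → ℝ) (hv : MemLp v 2 (volume : Measure (Rn n))),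
      (∀ y, y ∉ B → v y = 0) → inner ℝ (hv.toLp v) (hκm.toLp κ) = ∫ y, K z y * v y := by
    intro v hv hv0
    rw [L2.inner_def]
    apply integral_congr_ae
    filter_upwards [hv.coeFn_toLp, hκm.coeFn_toLp] with y h1 h2
    rw [h1, h2]
    by_cases hy : y ∈ B
    · simp [hκ, hy]
    · simp [hv0 y hy]
  have hlim2 : Tendsto (fun k => ∫ y, K z y * w k y) atTop (𝓝 (∫ y, K z y * g y)) := by
    have := (hlim.inner (𝕜 := ℝ) (tendsto_const_nhds (x := hκm.toLp κ)))
    rw [hinner g hg hgsub] at this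
    exact this.congr fun k => hinner _ (hw3 k) (hwsub k)
  refine tendsto_nhds_unique hz1 ?_
  refine (hlim2.comp hns.tendsto_atTop).congr fun k => ?_
  exact (hz2 (ns k) (hzn _)).symm


lemma vol_ball {n : ℕ} (c : Rn n) (R : ℝ) (hR : 0 < R) :
    volume (ball c R) = volume (ball (0 : Rn n) 1) * ENNReal.ofReal (R ^ n) := by
  rw [Measure.addHaar_ball_of_pos volume c hR, finrank_euclideanSpace_fin, mul_comm]

lemma bad_far {n : ℕ} {θ : ℝ → ℝ} (hθ : IsModulus θ) {C₀ : ℝ} {K : Rn n → Rn n → ℝ}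
    (hK : IsThetaKernel n θ C₀ K)
    {T : Lp ℝ 2 (volume : Measure (Rn n)) →L[ℝ] Lp ℝ 2 (volume : Measure (Rn n))}
    (hT : IsCZO n K T) (b : Rn n → ℝ) (hb : MemLp b 2 (volume : Measure (Rn n)))
    (hbi : Integrable b) (hb0 : ∫ y, b y = 0)
    (c : Rn n) (δ : ℝ) (hδ : 0 < δ) (hsupp : ∀ y, y ∉ closedBall c δ → b y = 0) :
    ∀ᵐ z : Rn n, 2 * δ < dist c z → |(T (hb.toLp b) : Rn n → ℝ) z| ≤
      (θ (δ / dist c z) / dist c z ^ n) * ∫ y, |b y| := by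
  filter_upwards [czo_ext hθ hK hT b hb c δ hδ hsupp] with z hz1 hz2
  rw [hz1 hz2]
  obtain ⟨hc, hm, hs, h0, hp⟩ := id hθ
  set B := closedBall c δ with hB
  have hdz : 0 < dist c z := by linarith
  have hzB : z ∉ B := by
    intro h; rw [hB, mem_closedBall, dist_comm] at h; linarith
  have hKm : AEStronglyMeasurable (K z) (volume.restrict B) :=
    (kernel_contOn hθ hK z B hzB).aestronglyMeasurable measurableSet_closedBall
  have hbd : ∀ y, |(K z y - K z c) * b y| ≤ (θ (δ / dist c z) / dist c z ^ n) * |b y| := by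
    intro y
    by_cases hy : y ∈ B
    · rw [abs_mul]
      gcongr
      have hy' : ‖c - y‖ ≤ δ := by rw [← dist_eq_norm, dist_comm]; exact hy
      have hcz : c ≠ z := by intro h; simp [h] at hdz
      have h1 := hK.2 c y z hcz (by rw [← dist_eq_norm c z]; linarith)
      rw [← dist_eq_norm c z] at h1
      have h2 : θ (‖c - y‖ / dist c z) ≤ θ (δ / dist c z) := by
        have h3 : ‖c - y‖ / dist c z ≤ δ / dist c z := by gcongr
        have h4 : δ / dist c z ≤ 1 := by rw [div_le_one hdz]; linarith
        exact hm ⟨by positivity, h3.trans h4⟩ ⟨by positivity, h4⟩ h3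
      calc |K z y - K z c| = |K z c - K z y| := abs_sub_comm _ _
        _ ≤ θ (‖c - y‖ / dist c z) / dist c z ^ n := by linarith [abs_nonneg (K c z - K y z)]
        _ ≤ _ := by gcongr
    · simp [hsupp y hy]
  have hint1 : Integrable (fun y => (K z y - K z c) * b y) := by
    refine Integrable.mono' (hbi.abs.const_mul (θ (δ / dist c z) / dist c z ^ n)) ?_
      (Eventually.of_forall hbd)
    have : (fun y => (K z y - K z c) * b y) = B.indicator (fun y => (K z y - K z c) * b y) := by
      ext y
      by_cases hy : y ∈ B
      · simp [hy]
      · simp [hy, hsupp y hy]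
    rw [this, aestronglyMeasurable_indicator_iff measurableSet_closedBall]
    exact (hKm.sub aestronglyMeasurable_const).mul hbi.1.restrict
  have heq : ∫ y, K z y * b y = ∫ y, (K z y - K z c) * b y := by
    have : ∀ y, K z y * b y = (K z y - K z c) * b y + K z c * b y := fun y => by ring
    simp_rw [this]
    rw [integral_add hint1 (hbi.const_mul _), integral_const_mul, hb0]
    simp
  rw [heq, ← integral_const_mul]
  refine (abs_integral_le_integral_abs).trans ?_
  exact integral_mono hint1.abs (hbi.abs.const_mul _) hbd

lemma bad_far_int {n : ℕ} {θ : ℝ → ℝ} (hθ : IsModulus θ) {C₀ : ℝ} {K : Rn n → Rn n → ℝ}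
    (hK : IsThetaKernel n θ C₀ K)
    {T : Lp ℝ 2 (volume : Measure (Rn n)) →L[ℝ] Lp ℝ 2 (volume : Measure (Rn n))}
    (hT : IsCZO n K T) (b : Rn n → ℝ) (hb : MemLp b 2 (volume : Measure (Rn n)))
    (hbi : Integrable b) (hb0 : ∫ y, b y = 0)
    (c : Rn n) (δ : ℝ) (hδ : 0 < δ) (hsupp : ∀ y, y ∉ closedBall c δ → b y = 0) :
    ∫⁻ z in {z : Rn n | 2 * δ < dist c z}, ENNReal.ofReal |(T (hb.toLp b) : Rn n → ℝ) z| ≤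
      diniSum θ * (volume (ball (0 : Rn n) 1) * ENNReal.ofReal (2 ^ n)) *
        ENNReal.ofReal (∫ y, |b y|) := by
  have hd : Measurable (fun y : Rn n => dist c y) := by fun_prop
  have hms : MeasurableSet {z : Rn n | 2 * δ < dist c z} := measurableSet_lt measurable_const hd
  calc _ ≤ ∫⁻ z in {z : Rn n | 2 * δ < dist c z},
        ENNReal.ofReal (θ (δ / dist c z) / dist c z ^ n) * 1 * ENNReal.ofReal (∫ y, |b y|) := by
        apply lintegral_mono_ae
        filter_upwards [ae_restrict_of_ae (bad_far hθ hK hT b hb hbi hb0 c δ hδ hsupp),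
          ae_restrict_mem hms] with z h1 h2
        have h3 : 0 ≤ ∫ y, |b y| := integral_nonneg fun _ => abs_nonneg _
        rw [mul_one, ← ENNReal.ofReal_mul' h3]
        exact ENNReal.ofReal_le_ofReal (h1 h2)
    _ = (∫⁻ z in {z : Rn n | 2 * δ < dist c z},
        ENNReal.ofReal (θ (δ / dist c z) / dist c z ^ n) * 1) * ENNReal.ofReal (∫ y, |b y|) :=
        lintegral_mul_const' _ _ ENNReal.ofReal_ne_top
    _ ≤ _ := by
        gcongr
        refine le_trans (lintegral_mono_set ?_) (annuli hθ (fun _ => 1) c δ hδ _ ?_)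
        · intro z hz
          exact (show 2 * δ < dist c z from hz).le
        · intro R hR
          simp [vol_ball c R hR]


def cidx {n : ℕ} (h : ℝ) (y : Rn n) : Fin n → ℤ := fun i => ⌊y i / h⌋

def cell {n : ℕ} (h : ℝ) (m : Fin n → ℤ) : Set (Rn n) := {y | cidx h y = m}

lemma mem_cell {n : ℕ} {h : ℝ} {m : Fin n → ℤ} {y : Rn n} : y ∈ cell h m ↔ cidx h y = m := Iff.rfl

lemma mem_cell_iff {n : ℕ} {h : ℝ} (hh : 0 < h) {m : Fin n → ℤ} {y : Rn n} :
    y ∈ cell h m ↔ ∀ i, y i ∈ Ico (m i * h) ((m i + 1) * h) := by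
  rw [mem_cell, funext_iff]
  refine forall_congr' fun i => ?_
  rw [cidx, Int.floor_eq_iff, le_div_iff₀ hh, div_lt_iff₀ hh, mem_Ico]

lemma cell_eq {n : ℕ} {h : ℝ} (hh : 0 < h) (m : Fin n → ℤ) :
    cell h m = (WithLp.ofLp (p := 2)) ⁻¹' (univ.pi fun i => Ico (m i * h) ((m i + 1) * h)) := by
  ext y
  rw [mem_cell_iff hh]
  simp [Set.mem_pi]

lemma cell_meas {n : ℕ} {h : ℝ} (hh : 0 < h) (m : Fin n → ℤ) : MeasurableSet (cell h m) := by
  rw [cell_eq hh]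
  exact (PiLp.volume_preserving_ofLp (Fin n)).measurable
    (MeasurableSet.univ_pi fun i => measurableSet_Ico)

lemma cell_vol {n : ℕ} {h : ℝ} (hh : 0 < h) (m : Fin n → ℤ) :
    volume (cell h m) = ENNReal.ofReal (h ^ n) := by
  rw [cell_eq hh, (PiLp.volume_preserving_ofLp (Fin n)).measure_preimage
    (MeasurableSet.univ_pi fun i => measurableSet_Ico).nullMeasurableSet, Real.volume_pi_Ico]
  have : ∀ i, ((m i : ℝ) + 1) * h - m i * h = h := fun i => by ring
  simp_rw [this]
  rw [Finset.prod_const, ENNReal.ofReal_pow hh.le]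
  simp

lemma cell_real {n : ℕ} {h : ℝ} (hh : 0 < h) (m : Fin n → ℤ) :
    volume.real (cell h m) = h ^ n := by
  rw [Measure.real, cell_vol hh, ENNReal.toReal_ofReal (by positivity)]

lemma norm_le_of_coord {n : ℕ} {h : ℝ} (y : Rn n) (hy : ∀ i, |y i| ≤ h) : ‖y‖ ≤ n * h := by
  have h1 : ‖y‖ ≤ ∑ i, |y i| := by
    rw [EuclideanSpace.norm_eq]
    apply Real.sqrt_le_iff.2
    constructor
    · exact Finset.sum_nonneg fun _ _ => abs_nonneg _
    · simp only [Real.norm_eq_abs]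
      exact Finset.sum_sq_le_sq_sum_of_nonneg fun _ _ => abs_nonneg _
  refine h1.trans ?_
  calc _ ≤ ∑ i : Fin n, h := Finset.sum_le_sum fun i _ => hy i
    _ = _ := by simp

lemma cell_dist {n : ℕ} {h : ℝ} (hh : 0 < h) {m : Fin n → ℤ} {y z : Rn n}
    (hy : y ∈ cell h m) (hz : z ∈ cell h m) : dist y z ≤ n * h := by
  rw [dist_eq_norm]
  apply norm_le_of_coord
  intro i
  have h1 := (mem_cell_iff hh).1 hy i
  have h2 := (mem_cell_iff hh).1 hz i
  rw [PiLp.sub_apply, abs_le]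
  constructor <;> nlinarith [h1.1, h1.2, h2.1, h2.2]

def corner {n : ℕ} (h : ℝ) (m : Fin n → ℤ) : Rn n := WithLp.toLp 2 (fun i => m i * h)

lemma corner_mem {n : ℕ} {h : ℝ} (hh : 0 < h) (m : Fin n → ℤ) : corner h m ∈ cell h m := by
  rw [mem_cell_iff hh]
  intro i
  simp [corner, hh]

lemma cidx_anc {n : ℕ} {s : ℝ} (y : Rn n) {j k : ℕ} (hjk : j ≤ k) :
    cidx (s / 2^j) y = fun i => cidx (s / 2^k) y i / 2^(k-j) := by
  funext i
  obtain ⟨d, rfl⟩ := Nat.exists_eq_add_of_le hjk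
  simp only [cidx, Nat.add_sub_cancel_left]
  have := Int.floor_div_natCast (y i / (s / 2^(j+d))) (2^d)
  push_cast at this
  rw [← this]
  congr 1
  rw [pow_add]
  field_simp


lemma cz_cubes {n : ℕ} (hn : 1 ≤ n) (φ : Rn n → ℝ) (hφ : Continuous φ) (hφc : HasCompactSupport φ)
    (L : ℝ) (hL : 0 < L) :
    ∃ (s : ℝ) (F : Finset (ℕ × (Fin n → ℤ))), 0 < s ∧
      ((F : Set (ℕ × (Fin n → ℤ))).PairwiseDisjoint fun p => cell (s / 2 ^ p.1) p.2) ∧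
      (∀ p ∈ F, L * (s / 2 ^ p.1) ^ n < ∫ y in cell (s / 2 ^ p.1) p.2, |φ y|) ∧
      (∀ p ∈ F, ∫ y in cell (s / 2 ^ p.1) p.2, |φ y| ≤ 2 ^ n * L * (s / 2 ^ p.1) ^ n) ∧
      ∀ y, (∀ p ∈ F, y ∉ cell (s / 2 ^ p.1) p.2) → |φ y| ≤ 2 * L := by
  classical
  have hφi : Integrable φ := hφ.integrable_of_hasCompactSupport hφc
  set s : ℝ := max 1 ((∫ y, |φ y|) / L) with hs
  have hs1 : 1 ≤ s := le_max_left _ _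
  have hs0 : 0 < s := by linarith
  have hh : ∀ k : ℕ, 0 < s / 2 ^ k := fun k => by positivity
  have huc := hφc.uniformContinuous_of_continuous hφ
  obtain ⟨η, hη, hηφ⟩ := Metric.uniformContinuous_iff.1 huc L hL
  obtain ⟨N, hN⟩ : ∃ N : ℕ, n * (s / 2 ^ N) < η := by
    obtain ⟨N, hN⟩ := pow_unbounded_of_one_lt (n * s / η) (by norm_num : (1:ℝ) < 2)
    refine ⟨N, ?_⟩
    rw [div_lt_iff₀ hη] at hN
    rw [← mul_div_assoc, div_lt_iff₀ (by positivity)]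
    linarith
  set big : ℕ → (Fin n → ℤ) → Prop := fun k m =>
    L * (s / 2 ^ k) ^ n < ∫ y in cell (s / 2 ^ k) m, |φ y| with hbig
  have hbig0 : ∀ m, ¬ big 0 m := by
    intro m
    simp only [hbig, not_lt, pow_zero, div_one]
    calc ∫ y in cell s m, |φ y| ≤ ∫ y, |φ y| :=
          setIntegral_le_integral hφi.abs (Eventually.of_forall fun _ => abs_nonneg _)
      _ ≤ L * s := by
          have : (∫ y, |φ y|) / L ≤ s := le_max_right _ _
          rw [div_le_iff₀ hL] at this
          linarith
      _ ≤ L * s ^ n := by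
          gcongr
          exact le_self_pow₀ hs1 (by omega)
  set F' : Set (ℕ × (Fin n → ℤ)) := {p | p.1 ≤ N ∧ big p.1 p.2 ∧
    ∀ j < p.1, ¬ big j (fun i => p.2 i / 2 ^ (p.1 - j))} with hF'
  obtain ⟨R, hR⟩ := hφc.isCompact.isBounded.subset_closedBall (0 : Rn n)
  have hfin : F'.Finite := by
    apply Set.Finite.subset (s := ⋃ k ∈ Set.Iic N, ({k} ×ˢ
      Set.Icc (fun _ : Fin n => ⌊-R / (s/2^k)⌋) (fun _ : Fin n => ⌊R / (s/2^k)⌋)))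
    · exact (Set.finite_Iic N).biUnion fun k _ => (Set.finite_singleton k).prod (Set.finite_Icc _ _)
    · rintro ⟨k, m⟩ ⟨h1, h2, -⟩
      simp only at h1 h2
      have : ∃ y ∈ cell (s/2^k) m, φ y ≠ 0 := by
        by_contra! hcon
        have h3 : ∫ y in cell (s / 2 ^ k) m, |φ y| = 0 := by
          rw [setIntegral_congr_fun (g := fun _ => (0:ℝ)) (cell_meas (hh k) m)]
          · simp
          · intro y hy; simp [hcon y hy]
        rw [hbig] at h2
        simp only [h3] at h2
        have : 0 < L * (s / 2 ^ k) ^ n := mul_pos hL (pow_pos (hh k) n)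
        linarith
      obtain ⟨y, hy1, hy2⟩ := this
      have hyR : ‖y‖ ≤ R := by
        simpa using hR (subset_tsupport φ hy2)
      have hyi : ∀ i, |y i| ≤ R := fun i => (PiLp.norm_apply_le y i).trans hyR
      simp only [mem_iUnion]
      refine ⟨k, h1, rfl, ?_⟩
      have hm : m = cidx (s/2^k) y := hy1.symm
      simp only [hm]
      constructor
      · intro i
        exact Int.floor_le_floor (div_le_div_of_nonneg_right (abs_le.1 (hyi i)).1 (hh k).le)
      · intro i
        exact Int.floor_le_floor (div_le_div_of_nonneg_right (abs_le.1 (hyi i)).2 (hh k).le)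
  have hmem : ∀ p, p ∈ hfin.toFinset ↔ p.1 ≤ N ∧ big p.1 p.2 ∧
    ∀ j < p.1, ¬ big j (fun i => p.2 i / 2 ^ (p.1 - j)) := fun p => hfin.mem_toFinset
  have hlt : ∀ p ∈ F', ∀ q ∈ F', ∀ y, y ∈ cell (s / 2 ^ p.1) p.2 → y ∈ cell (s / 2 ^ q.1) q.2 →
      ¬ p.1 < q.1 := by
    intro p hp q hq y hyp hyq hpq
    have h1 := hq.2.2 p.1 hpq
    have h2 := cidx_anc (s := s) y hpq.le
    rw [mem_cell.1 hyp, mem_cell.1 hyq] at h2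
    rw [← h2] at h1
    exact h1 hp.2.1
  refine ⟨s, hfin.toFinset, hs0, ?_, ?_, ?_, ?_⟩
  · intro p hp q hq hpq
    rw [Function.onFun, Set.disjoint_left]
    intro y hyp hyq
    have hp' : p ∈ F' := hfin.mem_toFinset.1 hp
    have hq' : q ∈ F' := hfin.mem_toFinset.1 hq
    have h1 : p.1 = q.1 := le_antisymm (not_lt.1 (hlt q hq' p hp' y hyq hyp))
      (not_lt.1 (hlt p hp' q hq' y hyp hyq))
    apply hpq
    refine Prod.ext h1 ?_
    rw [← mem_cell.1 hyp, ← mem_cell.1 hyq, h1]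
  · intro p hp
    exact ((hmem p).1 hp).2.1
  · intro p hp
    obtain ⟨h1, h2, h3⟩ := (hmem p).1 hp
    obtain ⟨k, m⟩ := p
    simp only at h1 h2 h3 ⊢
    rcases k with _ | k
    · exact absurd h2 (hbig0 m)
    have h4 := h3 k (by omega)
    simp only [hbig, not_lt] at h4
    have hsub : cell (s / 2^(k+1)) m ⊆ cell (s / 2^k) (fun i => m i / 2 ^ (k + 1 - k)) := by
      intro y hy
      rw [mem_cell] at hy ⊢
      rw [cidx_anc y (Nat.le_succ k), ← hy]
    calc _ ≤ ∫ y in cell (s / 2^k) (fun i => m i / 2 ^ (k + 1 - k)), |φ y| :=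
          setIntegral_mono_set hφi.abs.integrableOn (Eventually.of_forall fun _ => abs_nonneg _)
            (LE.le.eventuallyLE hsub)
      _ ≤ _ := h4
      _ = _ := by
        rw [show s / 2^k = 2 * (s / 2^(k+1)) by rw [pow_succ]; field_simp, mul_pow]
        ring
  · intro y hy
    have hnb : ¬ big N (cidx (s/2^N) y) := by
      intro hb
      have hex : ∃ k, big k (cidx (s/2^k) y) := ⟨N, hb⟩
      have hle := Nat.find_min' hex hb
      refine hy (Nat.find hex, cidx (s/2^(Nat.find hex)) y) ((hmem _).2 ⟨hle, Nat.find_spec hex, ?_⟩) rfl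
      intro j hj
      have := Nat.find_min hex hj
      rwa [cidx_anc y hj.le] at this
    simp only [hbig, not_lt] at hnb
    set Q := cell (s/2^N) (cidx (s/2^N) y) with hQ
    have hv : 0 < (s/2^N)^n := pow_pos (hh N) n
    have hQv : volume.real Q = (s/2^N)^n := cell_real (hh N) _
    have h1 : (|φ y| - L) * (s/2^N)^n ≤ ∫ z in Q, |φ z| := by
      have : ∫ z in Q, (|φ y| - L) = (|φ y| - L) * (s/2^N)^n := by
        rw [setIntegral_const, hQv, smul_eq_mul, mul_comm]
      rw [← this]
      apply setIntegral_mono_on _ hφi.abs.integrableOn (cell_meas (hh N) _)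
      · intro z hz
        have hd : dist y z < η := (cell_dist (hh N) (m := cidx (s/2^N) y) rfl hz).trans_lt hN
        have := hηφ hd
        rw [Real.dist_eq] at this
        have := abs_sub_abs_le_abs_sub (φ y) (φ z)
        linarith
      · apply integrableOn_const
        · rw [cell_vol (hh N)]; exact ENNReal.ofReal_ne_top
        · simp
    have h2 : (|φ y| - L) * (s/2^N)^n ≤ L * (s/2^N)^n := h1.trans hnb
    have := le_of_mul_le_mul_right h2 hv
    linarith


lemma cz_decomp {n : ℕ} (hn : 1 ≤ n) (φ : Rn n → ℝ) (hφ : Continuous φ) (hφc : HasCompactSupport φ)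
    (L : ℝ) (hL : 0 < L) :
    ∃ (F : Finset (ℕ × (Fin n → ℤ))) (c : ℕ × (Fin n → ℤ) → Rn n) (δ : ℕ × (Fin n → ℤ) → ℝ)
      (b : ℕ × (Fin n → ℤ) → Rn n → ℝ),
      (∀ p, 0 < δ p) ∧ (∀ p, MemLp (b p) 2 (volume : Measure (Rn n))) ∧ (∀ p, Integrable (b p)) ∧
      (∀ p, ∫ y, b p y = 0) ∧ (∀ p, ∀ y, y ∉ closedBall (c p) (δ p) → b p y = 0) ∧
      (∀ y, |φ y - ∑ p ∈ F, b p y| ≤ (2 ^ n + 2) * L) ∧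
      (∑ p ∈ F, ∫ y, |b p y| ≤ 2 * ∫ y, |φ y|) ∧
      (∑ p ∈ F, δ p ^ n ≤ n ^ n * (∫ y, |φ y|) / L) := by
  classical
  obtain ⟨s, F, hs, hdisj, hlow, hup, hout⟩ := cz_cubes hn φ hφ hφc L hL
  have hφi : Integrable φ := hφ.integrable_of_hasCompactSupport hφc
  have hφ2 : MemLp φ 2 (volume : Measure (Rn n)) := hφ.memLp_of_hasCompactSupport hφc
  have hh : ∀ k : ℕ, 0 < s / 2 ^ k := fun k => by positivity
  set Q : ℕ × (Fin n → ℤ) → Set (Rn n) := fun p => cell (s / 2 ^ p.1) p.2 with hQ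
  have hQm : ∀ p, MeasurableSet (Q p) := fun p => cell_meas (hh _) _
  have hQv : ∀ p, volume.real (Q p) = (s / 2 ^ p.1) ^ n := fun p => cell_real (hh _) _
  have hQt : ∀ p, volume (Q p) ≠ ⊤ := fun p => by
    simp only [hQ]; rw [cell_vol (hh _)]; exact ENNReal.ofReal_ne_top
  have hv : ∀ p : ℕ × (Fin n → ℤ), 0 < (s / 2 ^ p.1) ^ n := fun p => pow_pos (hh _) n
  set a : ℕ × (Fin n → ℤ) → ℝ := fun p => (∫ y in Q p, φ y) / (s / 2 ^ p.1) ^ n with ha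
  set b : ℕ × (Fin n → ℤ) → Rn n → ℝ := fun p => (Q p).indicator (fun y => φ y - a p) with hb
  have hal : ∀ p, |a p| * (s / 2 ^ p.1) ^ n ≤ ∫ y in Q p, |φ y| := by
    intro p
    simp only [ha]
    rw [abs_div, abs_of_pos (hv p), div_mul_cancel₀ _ (hv p).ne']
    exact abs_integral_le_integral_abs
  have hci : ∀ p (t : ℝ), IntegrableOn (fun _ => t) (Q p) volume := fun p t =>
    integrableOn_const (hQt p)
  have hbi : ∀ p, Integrable (b p) := by
    intro p
    rw [hb, integrable_indicator_iff (hQm p)]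
    exact hφi.integrableOn.sub (hci p _)
  have hbabs : ∀ p, ∫ y, |b p y| ≤ 2 * ∫ y in Q p, |φ y| := by
    intro p
    have h1 : ∀ y, |b p y| = (Q p).indicator (fun y => |φ y - a p|) y := by
      intro y
      by_cases hy : y ∈ Q p <;> simp [hb, hy]
    simp_rw [h1]
    rw [integral_indicator (hQm p)]
    calc _ ≤ ∫ y in Q p, (|φ y| + |a p|) := by
          apply integral_mono
          · exact (hφi.integrableOn.sub (hci p _)).abs
          · exact hφi.abs.integrableOn.add (hci p _)
          · intro y; exact abs_sub _ _
      _ = (∫ y in Q p, |φ y|) + (s / 2 ^ p.1) ^ n * |a p| := by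
          rw [integral_add hφi.abs.integrableOn (hci p _), setIntegral_const, hQv, smul_eq_mul]
      _ ≤ _ := by linarith [hal p]
  have hsumQ : ∑ p ∈ F, ∫ y in Q p, |φ y| ≤ ∫ y, |φ y| := by
    rw [← integral_biUnion_finset F (fun p _ => hQm p) hdisj (fun p _ => hφi.abs.integrableOn)]
    exact setIntegral_le_integral hφi.abs (Eventually.of_forall fun _ => abs_nonneg _)
  refine ⟨F, fun p => corner (s / 2 ^ p.1) p.2, fun p => n * (s / 2 ^ p.1), b, ?_, ?_, hbi, ?_, ?_,
    ?_, ?_, ?_⟩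
  · intro p
    have : (0:ℝ) < n := by exact_mod_cast hn
    exact mul_pos this (hh _)
  · intro p
    rw [hb, memLp_indicator_iff_restrict (hQm p)]
    have : IsFiniteMeasure (volume.restrict (Q p)) := ⟨by simpa using (hQt p).lt_top⟩
    exact hφ2.restrict _ |>.sub (memLp_const _)
  · intro p
    rw [hb, integral_indicator (hQm p), integral_sub hφi.integrableOn (hci p _), setIntegral_const,
      hQv, smul_eq_mul]
    simp only [ha]
    rw [mul_div_cancel₀ _ (hv p).ne', sub_self]
  · intro p y hy
    apply indicator_of_notMem
    intro hyQ
    exact hy (mem_closedBall.2 (cell_dist (hh _) hyQ (corner_mem (hh _) _)))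
  · intro y
    by_cases hy : ∃ p ∈ F, y ∈ Q p
    · obtain ⟨p, hp, hyp⟩ := hy
      have : ∑ q ∈ F, b q y = b p y := by
        apply Finset.sum_eq_single_of_mem p hp
        intro q hq hqp
        apply indicator_of_notMem
        intro hyq
        exact Set.disjoint_left.1 (hdisj hq hp hqp) hyq hyp
      rw [this]
      simp only [hb, indicator_of_mem hyp, sub_sub_cancel]
      have h1 : |a p| * (s / 2 ^ p.1) ^ n ≤ 2 ^ n * L * (s / 2 ^ p.1) ^ n := (hal p).trans (hup p hp)
      have := le_of_mul_le_mul_right h1 (hv p)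
      linarith
    · push Not at hy
      have : ∑ q ∈ F, b q y = 0 := Finset.sum_eq_zero fun q hq => indicator_of_notMem (hy q hq) _
      rw [this, sub_zero]
      have h1 := hout y hy
      have : 0 ≤ 2 ^ n * L := by positivity
      linarith
  · calc _ ≤ ∑ p ∈ F, 2 * ∫ y in Q p, |φ y| := Finset.sum_le_sum fun p _ => hbabs p
      _ = 2 * ∑ p ∈ F, ∫ y in Q p, |φ y| := by rw [Finset.mul_sum]
      _ ≤ _ := by linarith
  · simp only [mul_pow]
    rw [← Finset.mul_sum, mul_div_assoc]
    gcongr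
    rw [le_div_iff₀ hL, Finset.sum_mul]
    refine le_trans (Finset.sum_le_sum fun p hp => ?_) hsumQ
    have := hlow p hp
    simp only [hQ]
    linarith


lemma lp_norm_sq {n : ℕ} (u : Lp ℝ 2 (volume : Measure (Rn n))) :
    ‖u‖ ^ 2 = ∫ z, ((u : Rn n → ℝ) z) ^ 2 := by
  rw [← real_inner_self_eq_norm_sq, L2.inner_def]
  apply integral_congr_ae
  filter_upwards with z
  simp [sq]

lemma toLp_sum_ae {n : ℕ} {ι : Type*} (F : Finset ι)
    (T : Lp ℝ 2 (volume : Measure (Rn n)) →L[ℝ] Lp ℝ 2 (volume : Measure (Rn n)))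
    (φ g : Rn n → ℝ) (hφ : MemLp φ 2 (volume : Measure (Rn n)))
    (hg : MemLp g 2 (volume : Measure (Rn n))) (b : ι → Rn n → ℝ)
    (hb : ∀ p, MemLp (b p) 2 (volume : Measure (Rn n)))
    (h : ∀ y, φ y = g y + ∑ p ∈ F, b p y) :
    ∀ᵐ z : Rn n, (T (hφ.toLp φ) : Rn n → ℝ) z = (T (hg.toLp g) : Rn n → ℝ) z +
      ∑ p ∈ F, (T ((hb p).toLp (b p)) : Rn n → ℝ) z := by
  classical
  induction F using Finset.induction_on generalizing φ with
  | empty =>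
    have : φ = g := by ext y; simpa using h y
    subst this
    simp
  | insert q F hq ih =>
    have h1 : MemLp (fun y => φ y - b q y) 2 (volume : Measure (Rn n)) := hφ.sub (hb q)
    have h2 := ih (fun y => φ y - b q y) h1 (fun y => by rw [h y, Finset.sum_insert hq]; ring)
    have h3 : hφ.toLp φ = h1.toLp _ + (hb q).toLp (b q) := by
      rw [← MemLp.toLp_add]
      congr 1
      ext y; simp
    rw [h3, map_add]
    filter_upwards [h2, Lp.coeFn_add (T (h1.toLp _)) (T ((hb q).toLp (b q)))] with z hz1 hz2
    rw [hz2, Pi.add_apply, hz1, Finset.sum_insert hq]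
    ring

set_option maxHeartbeats 2000000 in
lemma weak_type {n : ℕ} (hn : 1 ≤ n) {θ : ℝ → ℝ} (hθ : IsModulus θ) (hD : DiniCondition θ)
    {C₀ : ℝ} {K : Rn n → Rn n → ℝ} (hK : IsThetaKernel n θ C₀ K)
    {T : Lp ℝ 2 (volume : Measure (Rn n)) →L[ℝ] Lp ℝ 2 (volume : Measure (Rn n))}
    (hT : IsCZO n K T) :
    ∃ A : ℝ, 0 < A ∧ ∀ (φ : Rn n → ℝ) (hφ2 : MemLp φ 2 (volume : Measure (Rn n))), Continuous φ →
      HasCompactSupport φ → ∀ L : ℝ, 0 < L →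
      volume {z : Rn n | L < |(T (hφ2.toLp φ) : Rn n → ℝ) z|} ≤
        ENNReal.ofReal (A * ((∫ y, |φ y|) / L)) := by
  set v : ℝ := (volume (ball (0 : Rn n) 1)).toReal with hv
  have hvE : volume (ball (0 : Rn n) 1) = ENNReal.ofReal v :=
    (ENNReal.ofReal_toReal measure_ball_lt_top.ne).symm
  have hv0 : 0 ≤ v := ENNReal.toReal_nonneg
  set D : ℝ := (diniSum θ).toReal with hDd
  have hDE : diniSum θ = ENNReal.ofReal D := (ENNReal.ofReal_toReal (diniSum_ne_top hθ hD)).symm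
  have hD0 : 0 ≤ D := ENNReal.toReal_nonneg
  refine ⟨12 * (2^n+2) * ‖T‖^2 + v * 3^n * n^n + 4 * (D * (v * 2^n)) + 1, by positivity, ?_⟩
  intro φ hφ2 hφ hφc L hL
  obtain ⟨F, c, δ, b, hδ, hb2, hbi, hb0, hbs, hgb, hbsum, hδsum⟩ := cz_decomp hn φ hφ hφc L hL
  have hφi : Integrable φ := hφ.integrable_of_hasCompactSupport hφc
  set I : ℝ := ∫ y, |φ y| with hI
  have hI0 : 0 ≤ I := integral_nonneg fun _ => abs_nonneg _
  set g : Rn n → ℝ := fun y => φ y - ∑ p ∈ F, b p y with hg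
  have hg2 : MemLp g 2 (volume : Measure (Rn n)) := hφ2.sub (memLp_finsetSum F fun p _ => hb2 p)
  have hsi : Integrable (fun y => ∑ p ∈ F, b p y) := integrable_finsetSum F fun p _ => hbi p
  have hgi : Integrable g := hφi.sub hsi
  have hgabs : ∫ y, |g y| ≤ 3 * I := by
    calc ∫ y, |g y| ≤ ∫ y, (|φ y| + ∑ p ∈ F, |b p y|) := by
          apply integral_mono hgi.abs
          · exact hφi.abs.add (integrable_finsetSum F fun p _ => (hbi p).abs)
          · intro y
            calc |g y| ≤ |φ y| + |∑ p ∈ F, b p y| := abs_sub _ _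
              _ ≤ _ := add_le_add le_rfl (Finset.abs_sum_le_sum_abs _ _)
      _ = I + ∑ p ∈ F, ∫ y, |b p y| := by
          rw [integral_add hφi.abs (integrable_finsetSum F fun p _ => (hbi p).abs),
            integral_finsetSum F fun p _ => (hbi p).abs]
      _ ≤ _ := by linarith
  have hgsq : ∫ y, (g y)^2 ≤ (2^n+2) * L * (3 * I) := by
    calc ∫ y, (g y)^2 ≤ ∫ y, (2^n+2) * L * |g y| := by
          apply integral_mono hg2.integrable_sq (hgi.abs.const_mul _)
          intro y
          simp only
          rw [← sq_abs, sq]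
          exact mul_le_mul_of_nonneg_right (hgb y) (abs_nonneg _)
      _ = (2^n+2) * L * ∫ y, |g y| := integral_const_mul _ _
      _ ≤ _ := by gcongr
  set Tg := T (hg2.toLp g) with hTg
  have hTgsq : ∫ z, ((Tg : Rn n → ℝ) z)^2 ≤ ‖T‖^2 * ((2^n+2) * L * (3 * I)) := by
    rw [← lp_norm_sq]
    have h1 : ‖hg2.toLp g‖^2 = ∫ y, (g y)^2 := by
      rw [lp_norm_sq]
      apply integral_congr_ae
      filter_upwards [hg2.coeFn_toLp] with y hy
      rw [hy]
    calc ‖Tg‖^2 ≤ (‖T‖ * ‖hg2.toLp g‖)^2 := by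
          gcongr; exact T.le_opNorm _
      _ = ‖T‖^2 * ∫ y, (g y)^2 := by rw [mul_pow, h1]
      _ ≤ _ := by gcongr
  set E1 : Set (Rn n) := {z | ENNReal.ofReal ((L/2)^2) ≤ ENNReal.ofReal (((Tg : Rn n → ℝ) z)^2)} with hE1
  have hE1v : volume E1 ≤ ENNReal.ofReal (12 * (2^n+2) * ‖T‖^2 * (I / L)) := by
    have hint : Integrable (fun z => ((Tg : Rn n → ℝ) z)^2) := (Lp.memLp Tg).integrable_sq
    refine (meas_ge_le_lintegral_div hint.1.aemeasurable.ennreal_ofReal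
      (by simp; positivity) ENNReal.ofReal_ne_top).trans ?_
    rw [← ofReal_integral_eq_lintegral_ofReal hint (Eventually.of_forall fun _ => sq_nonneg _),
      ← ENNReal.ofReal_div_of_pos (by positivity)]
    apply ENNReal.ofReal_le_ofReal
    rw [div_le_iff₀ (by positivity)]
    refine hTgsq.trans (le_of_eq ?_)
    field_simp
    ring
  set U : Set (Rn n) := ⋃ p ∈ F, ball (c p) (3 * δ p) with hU
  have hUm : MeasurableSet U := Finset.measurableSet_biUnion F fun p _ => measurableSet_ball
  have hUv : volume U ≤ ENNReal.ofReal (v * 3^n * n^n * (I / L)) := by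
    calc volume U ≤ ∑ p ∈ F, volume (ball (c p) (3 * δ p)) := measure_biUnion_finset_le _ _
      _ = ∑ p ∈ F, ENNReal.ofReal (v * 3^n * δ p ^ n) := by
          apply Finset.sum_congr rfl
          intro p _
          rw [vol_ball _ _ (by have := hδ p; positivity), hvE, ← ENNReal.ofReal_mul hv0, mul_pow, mul_assoc]
      _ = ENNReal.ofReal (∑ p ∈ F, v * 3^n * δ p ^ n) := by
          rw [ENNReal.ofReal_sum_of_nonneg]
          intro p _
          have := hδ p
          positivity
      _ ≤ _ := by
          apply ENNReal.ofReal_le_ofReal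
          rw [← Finset.mul_sum]
          calc _ ≤ v * 3^n * (n ^ n * I / L) := by gcongr
            _ = _ := by ring
  set S : Rn n → ℝ≥0∞ := fun z => ∑ p ∈ F, ENNReal.ofReal |(T ((hb2 p).toLp (b p)) : Rn n → ℝ) z| with hS
  have hbm : ∀ p, AEMeasurable (fun z => ENNReal.ofReal |(T ((hb2 p).toLp (b p)) : Rn n → ℝ) z|) := fun p =>
    ((Lp.aestronglyMeasurable (T ((hb2 p).toLp (b p)))).aemeasurable.abs).ennreal_ofReal
  have hSm : AEMeasurable S := Finset.aemeasurable_fun_sum F fun p _ => hbm p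
  set E3 : Set (Rn n) := {z | ENNReal.ofReal (L/2) ≤ S z} with hE3
  have hE3v : volume (E3 ∩ Uᶜ) ≤ ENNReal.ofReal (4 * (D * (v * 2^n)) * (I / L)) := by
    rw [← Measure.restrict_apply' hUm.compl]
    refine (meas_ge_le_lintegral_div hSm.restrict
      (by simp; positivity) ENNReal.ofReal_ne_top).trans ?_
    have h1 : ∫⁻ z in Uᶜ, S z ≤ ENNReal.ofReal (D * (v * 2^n) * (2 * I)) := by
      simp only [hS]
      rw [lintegral_finsetSum' _ fun p _ => (hbm p).restrict]
      calc _ ≤ ∑ p ∈ F, ENNReal.ofReal (D * (v * 2^n) * ∫ y, |b p y|) := by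
            apply Finset.sum_le_sum
            intro p hp
            have h2 := bad_far_int hθ hK hT (b p) (hb2 p) (hbi p) (hb0 p) (c p) (δ p) (hδ p) (hbs p)
            rw [hDE, hvE, ← ENNReal.ofReal_mul hv0, ← ENNReal.ofReal_mul hD0,
              ← ENNReal.ofReal_mul (by positivity)] at h2
            refine le_trans (lintegral_mono_set ?_) h2
            intro z hz
            change 2 * δ p < dist (c p) z
            by_contra! hcon
            apply hz
            refine mem_biUnion (show p ∈ (F : Set _) from hp) (mem_ball'.2 ?_)
            have := hδ p
            linarith
        _ = ENNReal.ofReal (∑ p ∈ F, D * (v * 2^n) * ∫ y, |b p y|) := by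
            rw [ENNReal.ofReal_sum_of_nonneg]
            intro p _
            have : 0 ≤ ∫ y, |b p y| := integral_nonneg fun _ => abs_nonneg _
            positivity
        _ ≤ _ := by
            apply ENNReal.ofReal_le_ofReal
            rw [← Finset.mul_sum]
            gcongr
    calc _ ≤ ENNReal.ofReal (D * (v * 2^n) * (2 * I)) / ENNReal.ofReal (L/2) := by gcongr
      _ = _ := by
        rw [← ENNReal.ofReal_div_of_pos (by positivity)]
        congr 1
        field_simp
        ring
  have hae := toLp_sum_ae F T φ g hφ2 hg2 b hb2 (fun y => by simp [hg])
  have hsub : volume {z : Rn n | L < |(T (hφ2.toLp φ) : Rn n → ℝ) z|} ≤ volume (E1 ∪ (U ∪ (E3 ∩ Uᶜ))) := by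
    apply measure_mono_ae
    filter_upwards [hae] with z hz hzL
    change L < |(T (hφ2.toLp φ) : Rn n → ℝ) z| at hzL
    rw [hz] at hzL
    by_cases h1 : z ∈ E1
    · exact Or.inl h1
    by_cases h2 : z ∈ U
    · exact Or.inr (Or.inl h2)
    refine Or.inr (Or.inr ⟨?_, h2⟩)
    have h3 : |(Tg : Rn n → ℝ) z| < L/2 := by
      have : ¬ (ENNReal.ofReal ((L/2)^2) ≤ ENNReal.ofReal (((Tg : Rn n → ℝ) z)^2)) := h1
      rw [not_le, ENNReal.ofReal_lt_ofReal_iff (by positivity)] at this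
      exact abs_lt_of_sq_lt_sq this (by positivity)
    change ENNReal.ofReal (L/2) ≤ S z
    simp only [hS]
    rw [← ENNReal.ofReal_sum_of_nonneg fun _ _ => abs_nonneg _]
    apply ENNReal.ofReal_le_ofReal
    have h4 := abs_add_le ((Tg : Rn n → ℝ) z) (∑ p ∈ F, (T ((hb2 p).toLp (b p)) : Rn n → ℝ) z)
    have h5 := Finset.abs_sum_le_sum_abs (fun p => (T ((hb2 p).toLp (b p)) : Rn n → ℝ) z) F
    linarith
  refine hsub.trans ((measure_union_le _ _).trans ((add_le_add le_rfl (measure_union_le _ _)).trans ?_))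
  refine (add_le_add hE1v (add_le_add hUv hE3v)).trans ?_
  have hIL : 0 ≤ I / L := by positivity
  rw [← ENNReal.ofReal_add (by positivity) (by positivity), ← ENNReal.ofReal_add (by positivity) (by positivity)]
  apply ENNReal.ofReal_le_ofReal
  linarith


lemma max_ball {n : ℕ} (f : Rn n → ℝ) (x : Rn n) (R : ℝ) (hR : 0 < R) :
    ∫⁻ y in ball x R, ENNReal.ofReal |f y| ≤ maximal f x * volume (ball x R) := by
  have h1 : (volume (ball x R))⁻¹ * ∫⁻ y in ball x R, ENNReal.ofReal |f y| ≤ maximal f x :=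
    le_iSup₂ (f := fun (r : ℝ) (_ : 0 < r) =>
      (volume (ball x r))⁻¹ * ∫⁻ y in ball x r, ENNReal.ofReal |f y|) R hR
  have h0 : volume (ball x R) ≠ 0 := (measure_ball_pos volume x hR).ne'
  have ht : volume (ball x R) ≠ ⊤ := measure_ball_lt_top.ne
  rw [mul_comm, ← div_eq_mul_inv] at h1
  exact (ENNReal.div_le_iff h0 ht).1 h1

lemma max_ball_real {n : ℕ} (f : Rn n → ℝ) (hf : Integrable f) (x : Rn n) (R : ℝ) (hR : 0 < R)
    (hm : maximal f x ≠ ⊤) :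
    ∫ y in ball x R, |f y| ≤
      (maximal f x).toReal * ((volume (ball (0 : Rn n) 1)).toReal * R ^ n) := by
  have h := max_ball f x R hR
  rw [← ofReal_integral_eq_lintegral_ofReal hf.abs.integrableOn
    (Eventually.of_forall fun _ => abs_nonneg _)] at h
  have h2 := ENNReal.toReal_mono (ENNReal.mul_ne_top hm measure_ball_lt_top.ne) h
  rw [ENNReal.toReal_ofReal (integral_nonneg fun _ => abs_nonneg _), vol_ball x R hR,
    ENNReal.toReal_mul, ENNReal.toReal_mul, ENNReal.toReal_ofReal (by positivity)] at h2
  exact h2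

lemma kernel_mul_integrable {n : ℕ} {θ : ℝ → ℝ} (hθ : IsModulus θ) {C₀ : ℝ} {K : Rn n → Rn n → ℝ}
    (hK : IsThetaKernel n θ C₀ K) (z : Rn n) (ρ : ℝ) (hρ : 0 < ρ) (u : Rn n → ℝ)
    (hu : Integrable u) (hu0 : ∀ y, dist z y < ρ → u y = 0) :
    Integrable (fun y => K z y * u y) := by
  set B : Set (Rn n) := {y | ρ ≤ dist z y} with hB
  have hd : Measurable (fun y : Rn n => dist z y) := by fun_prop
  have hBm : MeasurableSet B := measurableSet_le measurable_const hd
  have hzB : z ∉ B := by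
    intro h
    have : ρ ≤ dist z z := h
    simp at this; linarith
  have hmem : ∀ y, y ∉ B → u y = 0 := fun y hy => hu0 y (not_le.1 hy)
  refine Integrable.mono' (hu.abs.const_mul (|C₀| / ρ ^ n)) ?_ (Eventually.of_forall fun y => ?_)
  · have : (fun y => K z y * u y) = B.indicator (fun y => K z y * u y) := by
      ext y
      by_cases hy : y ∈ B
      · rw [indicator_of_mem hy]
      · rw [indicator_of_notMem hy, hmem y hy, mul_zero]
    rw [this, aestronglyMeasurable_indicator_iff hBm]
    exact ((kernel_contOn hθ hK z B hzB).aestronglyMeasurable hBm).mul hu.1.restrict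
  · by_cases hy : y ∈ B
    · rw [Real.norm_eq_abs, abs_mul]
      gcongr
      exact kernel_bound hK z y ρ hρ hy
    · simp [hmem y hy]

/-- Size step. -/
lemma trunc_size {n : ℕ} {θ : ℝ → ℝ} (hθ : IsModulus θ) {C₀ : ℝ} {K : Rn n → Rn n → ℝ}
    (hK : IsThetaKernel n θ C₀ K) (f f2 : Rn n → ℝ) (hf : Integrable f) (hf2 : Integrable f2)
    (x : Rn n) (r : ℝ) (hr : 0 < r) (h0 : ∀ y, dist x y < r / 2 → f2 y = 0)
    (h1 : ∀ y, r < dist x y → f2 y = f y) (hle : ∀ y, |f2 y| ≤ |f y|) (hm : maximal f x ≠ ⊤) :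
    |∫ y in {y : Rn n | r < dist x y}, K x y * f y| ≤ |∫ y, K x y * f2 y| +
      |C₀| * 4 ^ n * (volume (ball (0 : Rn n) 1)).toReal * (maximal f x).toReal := by
  set Ω : Set (Rn n) := {y : Rn n | r < dist x y} with hΩ
  have hd : Measurable (fun y : Rn n => dist x y) := by fun_prop
  have hΩm : MeasurableSet Ω := measurableSet_lt measurable_const hd
  have hint := kernel_mul_integrable hθ hK x (r/2) (by positivity) f2 hf2 h0
  have e1 : ∫ y in Ω, K x y * f y = ∫ y in Ω, K x y * f2 y :=
    setIntegral_congr_fun hΩm fun y hy => by rw [h1 y hy]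
  have e2 := integral_add_compl hΩm hint
  have e3 : |∫ y in Ωᶜ, K x y * f2 y| ≤
      |C₀| * 4 ^ n * (volume (ball (0 : Rn n) 1)).toReal * (maximal f x).toReal := by
    calc |∫ y in Ωᶜ, K x y * f2 y| ≤ ∫ y in Ωᶜ, |K x y * f2 y| := abs_integral_le_integral_abs
      _ ≤ ∫ y in Ωᶜ, |C₀| / (r/2)^n * |f y| := by
          apply integral_mono hint.abs.integrableOn (hf.abs.const_mul _).integrableOn
          intro y
          simp only
          by_cases hy : dist x y < r / 2
          · rw [h0 y hy]; simp only [mul_zero, abs_zero]; positivity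
          · rw [abs_mul]
            exact mul_le_mul (kernel_bound hK x y _ (by positivity) (not_lt.1 hy)) (hle y)
              (abs_nonneg _) (by positivity)
      _ ≤ ∫ y in ball x (2*r), |C₀| / (r/2)^n * |f y| := by
          apply setIntegral_mono_set (hf.abs.const_mul _).integrableOn
            (Eventually.of_forall fun y => by simp only [Pi.zero_apply]; positivity)
          apply LE.le.eventuallyLE
          intro y hy
          have : ¬ (r < dist x y) := hy
          rw [mem_ball']
          linarith
      _ = |C₀| / (r/2)^n * ∫ y in ball x (2*r), |f y| := integral_const_mul _ _
      _ ≤ |C₀| / (r/2)^n * ((maximal f x).toReal * ((volume (ball (0 : Rn n) 1)).toReal * (2*r) ^ n)) := by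
          gcongr
          exact max_ball_real f hf x (2*r) (by positivity) hm
      _ = _ := by
          rw [show 2 * r = 4 * (r/2) by ring, mul_pow 4]
          field_simp
  rw [e1]
  have : ∫ y in Ω, K x y * f2 y = (∫ y, K x y * f2 y) - ∫ y in Ωᶜ, K x y * f2 y := by linarith
  rw [this]
  exact (abs_sub _ _).trans (add_le_add le_rfl e3)

/-- Regularity step. -/
lemma trunc_reg {n : ℕ} {θ : ℝ → ℝ} (hθ : IsModulus θ) (hD : DiniCondition θ)
    {C₀ : ℝ} {K : Rn n → Rn n → ℝ}
    (hK : IsThetaKernel n θ C₀ K) (f f2 : Rn n → ℝ) (hf2 : Integrable f2)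
    (x z : Rn n) (r : ℝ) (hr : 0 < r) (h0 : ∀ y, dist x y < r / 2 → f2 y = 0)
    (hle : ∀ y, |f2 y| ≤ |f y|) (hm : maximal f x ≠ ⊤) (hz : z ∈ ball x (r/4)) :
    |∫ y, K x y * f2 y| ≤ |∫ y, K z y * f2 y| +
      (diniSum θ).toReal * ((volume (ball (0 : Rn n) 1)).toReal * 2 ^ n) * (maximal f x).toReal := by
  obtain ⟨hc, hmo, hs, hth0, hp⟩ := id hθ
  have hzd : dist x z < r/4 := mem_ball'.1 hz
  have hint1 := kernel_mul_integrable hθ hK x (r/2) (by positivity) f2 hf2 h0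
  have hint2 := kernel_mul_integrable hθ hK z (r/4) (by positivity) f2 hf2 (fun y hy =>
    h0 y (by linarith [dist_triangle x z y]))
  have key : ENNReal.ofReal |(∫ y, K x y * f2 y) - ∫ y, K z y * f2 y| ≤
      diniSum θ * ((maximal f x * volume (ball (0 : Rn n) 1)) * ENNReal.ofReal (2 ^ n)) := by
    rw [← integral_sub hint1 hint2, ← Real.enorm_eq_ofReal_abs]
    refine (enorm_integral_le_lintegral_enorm _).trans ?_
    refine le_trans ?_ (annuli hθ (fun y => ENNReal.ofReal |f y|) x (r/4) (by positivity) _ ?_)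
    · have hd : Measurable (fun y : Rn n => dist x y) := by fun_prop
      have hms : MeasurableSet {y : Rn n | 2 * (r/4) ≤ dist x y} :=
        measurableSet_le measurable_const hd
      rw [← lintegral_indicator hms]
      apply lintegral_mono
      intro y
      beta_reduce
      by_cases hy : 2 * (r/4) ≤ dist x y
      · rw [indicator_of_mem (show y ∈ {y : Rn n | 2 * (r/4) ≤ dist x y} from hy)]
        have hxy : 0 < dist x y := by linarith
        have hne : x ≠ y := dist_pos.1 hxy
        have h2 := hK.2 x z y hne (by rw [← dist_eq_norm, ← dist_eq_norm]; linarith)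
        rw [← dist_eq_norm, ← dist_eq_norm] at h2
        have h3 : dist x z / dist x y ≤ r/4 / dist x y := by gcongr
        have h4 : r/4 / dist x y ≤ 1 := by rw [div_le_one hxy]; linarith
        have h5 : θ (dist x z / dist x y) ≤ θ (r/4 / dist x y) :=
          hmo ⟨by positivity, h3.trans h4⟩ ⟨by positivity, h4⟩ h3
        have h6 : |K x y - K z y| ≤ θ (r/4 / dist x y) / dist x y ^ n := by
          calc _ ≤ θ (dist x z / dist x y) / dist x y ^ n := by linarith [abs_nonneg (K y x - K y z)]
            _ ≤ _ := by gcongr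
        rw [← ENNReal.ofReal_mul' (abs_nonneg _), Real.enorm_eq_ofReal_abs]
        apply ENNReal.ofReal_le_ofReal
        rw [← sub_mul, abs_mul]
        exact mul_le_mul h6 (hle y) (abs_nonneg _) ((abs_nonneg _).trans h6)
      · rw [h0 y (by linarith)]
        simp
    · intro R hR
      have := max_ball f x R hR
      rwa [vol_ball x R hR, ← mul_assoc] at this
  have hfin := diniSum_ne_top hθ hD
  have hvt : volume (ball (0 : Rn n) 1) ≠ ⊤ := measure_ball_lt_top.ne
  have h2 := ENNReal.toReal_mono (ENNReal.mul_ne_top hfin (ENNReal.mul_ne_top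
    (ENNReal.mul_ne_top hm hvt) ENNReal.ofReal_ne_top)) key
  rw [ENNReal.toReal_ofReal (abs_nonneg _), ENNReal.toReal_mul, ENNReal.toReal_mul, ENNReal.toReal_mul,
    ENNReal.toReal_ofReal (by positivity)] at h2
  have h3 := abs_sub_abs_le_abs_sub (∫ y, K x y * f2 y) (∫ y, K z y * f2 y)
  linarith

/-- Selection of a good point. -/
lemma good_point {n : ℕ} (x : Rn n) (r : ℝ) (hr : 0 < r) (F F1 : Rn n → ℝ)
    (hF : AEMeasurable F) (γ : ℝ) (hγ : 0 < γ)
    (ha : maximal (fun z => |F z| ^ γ) x ≠ ⊤) (L B : ℝ) (hL : 0 < L)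
    (hLa : 4 * (maximal (fun z => |F z| ^ γ) x).toReal ≤ L ^ γ)
    (hF1 : volume {z | L < |F1 z|} ≤ ENNReal.ofReal (B / L * ((volume (ball (0 : Rn n) 1)).toReal * r ^ n)))
    (hLB : 4 * 4 ^ n * B ≤ L) (P : Rn n → Prop) (hP : ∀ᵐ z, P z) :
    ∃ z ∈ ball x (r/4), |F z| ≤ L ∧ |F1 z| ≤ L ∧ P z := by
  by_contra! hcon
  set v : ℝ := (volume (ball (0 : Rn n) 1)).toReal with hv
  have hvE : volume (ball (0 : Rn n) 1) = ENNReal.ofReal v :=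
    (ENNReal.ofReal_toReal measure_ball_lt_top.ne).symm
  have hv0 : 0 < v := ENNReal.toReal_pos (measure_ball_pos volume _ one_pos).ne' measure_ball_lt_top.ne
  set a := maximal (fun z => |F z| ^ γ) x with haa
  have hLγ : 0 < L ^ γ := Real.rpow_pos_of_pos hL γ
  have hvB : volume (ball x (r/4)) = ENNReal.ofReal (v * (r/4)^n) := by
    rw [vol_ball x _ (by positivity), hvE, ENNReal.ofReal_mul hv0.le]
  set E1 : Set (Rn n) := {z | ENNReal.ofReal (L ^ γ) ≤ ENNReal.ofReal (|F z| ^ γ)} with hE1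
  have hE1v : volume (E1 ∩ ball x (r/4)) ≤ ENNReal.ofReal (v * (r/4)^n / 4) := by
    rw [← Measure.restrict_apply' measurableSet_ball]
    refine (meas_ge_le_lintegral_div (hF.abs.pow_const γ).ennreal_ofReal.restrict
      (by simpa using hLγ) ENNReal.ofReal_ne_top).trans ?_
    have h1 := max_ball (fun z => |F z| ^ γ) x (r/4) (by positivity)
    rw [← haa, hvB, ← ENNReal.ofReal_toReal ha, ← ENNReal.ofReal_mul ENNReal.toReal_nonneg] at h1
    have h2 : ∀ z, |(|F z| ^ γ)| = |F z| ^ γ := fun z => abs_of_nonneg (by positivity)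
    simp_rw [h2] at h1
    calc _ ≤ ENNReal.ofReal (a.toReal * (v * (r/4)^n)) / ENNReal.ofReal (L ^ γ) := by gcongr
      _ ≤ _ := by
        rw [← ENNReal.ofReal_div_of_pos hLγ]
        apply ENNReal.ofReal_le_ofReal
        rw [div_le_iff₀ hLγ]
        have : 0 ≤ v * (r/4)^n := by positivity
        nlinarith
  have hE2v : volume {z | L < |F1 z|} ≤ ENNReal.ofReal (v * (r/4)^n / 4) := by
    refine hF1.trans (ENNReal.ofReal_le_ofReal ?_)
    rw [div_mul_eq_mul_div, div_le_iff₀ hL]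
    have h1 : r ^ n = 4 ^ n * (r/4)^n := by rw [← mul_pow]; congr 1; ring
    rw [h1]
    have : 0 ≤ v * (r/4)^n := by positivity
    nlinarith
  have hsub : volume (ball x (r/4)) ≤ volume ((E1 ∩ ball x (r/4)) ∪ {z | L < |F1 z|}) := by
    apply measure_mono_ae
    filter_upwards [hP] with z hPz hz
    by_cases h1 : |F z| ≤ L
    · by_cases h2 : |F1 z| ≤ L
      · exact absurd hPz (hcon z hz h1 h2)
      · exact Or.inr (not_le.1 h2)
    · refine Or.inl ⟨?_, hz⟩
      apply ENNReal.ofReal_le_ofReal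
      exact Real.rpow_le_rpow hL.le (not_le.1 h1).le hγ.le
  have hfinal := hsub.trans ((measure_union_le _ _).trans (add_le_add hE1v hE2v))
  have hq : 0 < v * (r/4)^n := by positivity
  rw [hvB, ← ENNReal.ofReal_add (by positivity) (by positivity),
    ENNReal.ofReal_le_ofReal_iff (by positivity)] at hfinal
  linarith


lemma cotlar_core {n : ℕ} {θ : ℝ → ℝ} (hθ : IsModulus θ) (hD : DiniCondition θ)
    {C₀ : ℝ} {K : Rn n → Rn n → ℝ} (hK : IsThetaKernel n θ C₀ K)
    {T : Lp ℝ 2 (volume : Measure (Rn n)) →L[ℝ] Lp ℝ 2 (volume : Measure (Rn n))}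
    (hT : IsCZO n K T) (A : ℝ) (hA : 0 < A)
    (hW : ∀ (φ : Rn n → ℝ) (hφ2 : MemLp φ 2 (volume : Measure (Rn n))), Continuous φ →
      HasCompactSupport φ → ∀ L : ℝ, 0 < L →
      volume {z : Rn n | L < |(T (hφ2.toLp φ) : Rn n → ℝ) z|} ≤
        ENNReal.ofReal (A * ((∫ y, |φ y|) / L)))
    (γ : ℝ) (hγ : 0 < γ) (f : Rn n → ℝ) (hf : MemLp f 2 (volume : Measure (Rn n)))
    (hfs : ContDiff ℝ (⊤ : ℕ∞) f) (hfc : HasCompactSupport f) (x : Rn n) (r : ℝ) (hr : 0 < r)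
    (ha : maximal (fun z => |(T (hf.toLp f) : Rn n → ℝ) z| ^ γ) x ≠ ⊤) (hm : maximal f x ≠ ⊤)
    (L : ℝ) (hL : 0 < L)
    (hLa : 4 * (maximal (fun z => |(T (hf.toLp f) : Rn n → ℝ) z| ^ γ) x).toReal ≤ L ^ γ)
    (hLm : 4 * 4 ^ n * (A * (maximal f x).toReal) ≤ L) :
    |∫ y in {y : Rn n | r < dist x y}, K x y * f y| ≤ 2 * L +
      ((diniSum θ).toReal * ((volume (ball (0 : Rn n) 1)).toReal * 2 ^ n) +
      |C₀| * 4 ^ n * (volume (ball (0 : Rn n) 1)).toReal) * (maximal f x).toReal := by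
  let χ : ContDiffBump x := ⟨r/2, r, by positivity, by linarith⟩
  set f1 : Rn n → ℝ := fun y => χ y * f y with hf1
  set f2 : Rn n → ℝ := fun y => f y - χ y * f y with hf2
  have hf1s : ContDiff ℝ (⊤:ℕ∞) f1 := χ.contDiff.mul hfs
  have hf1c : HasCompactSupport f1 := hfc.mul_left
  have hf2s : ContDiff ℝ (⊤:ℕ∞) f2 := hfs.sub hf1s
  have hf2c : HasCompactSupport f2 := hfc.sub hf1c
  have hf1m : MemLp f1 2 (volume : Measure (Rn n)) := hf1s.continuous.memLp_of_hasCompactSupport hf1c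
  have hf2m : MemLp f2 2 (volume : Measure (Rn n)) := hf2s.continuous.memLp_of_hasCompactSupport hf2c
  have hfi : Integrable f := hfs.continuous.integrable_of_hasCompactSupport hfc
  have hf1i : Integrable f1 := hf1s.continuous.integrable_of_hasCompactSupport hf1c
  have hf2i : Integrable f2 := hf2s.continuous.integrable_of_hasCompactSupport hf2c
  have h0 : ∀ y, dist x y < r/2 → f2 y = 0 := by
    intro y hy
    have : χ y = 1 := χ.one_of_mem_closedBall (mem_closedBall'.2 hy.le)
    simp [hf2, this]
  have hχ0 : ∀ y, r ≤ dist x y → χ y = 0 := fun y hy =>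
    χ.zero_of_le_dist (by rw [dist_comm]; exact hy)
  have h1 : ∀ y, r < dist x y → f2 y = f y := by
    intro y hy
    simp [hf2, hχ0 y hy.le]
  have hle : ∀ y, |f2 y| ≤ |f y| := by
    intro y
    have e : f2 y = (1 - χ y) * f y := by simp only [hf2]; ring
    rw [e, abs_mul]
    apply mul_le_of_le_one_left (abs_nonneg _)
    rw [abs_of_nonneg (by linarith [χ.le_one (x := y)])]
    linarith [χ.nonneg (x := y)]
  have hf1n : ∫ y, |f1 y| ≤ (maximal f x).toReal * ((volume (ball (0 : Rn n) 1)).toReal * r ^ n) := by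
    refine le_trans ?_ (max_ball_real f hfi x r hr hm)
    rw [← integral_indicator measurableSet_ball]
    apply integral_mono hf1i.abs (hfi.abs.indicator measurableSet_ball)
    intro y
    beta_reduce
    by_cases hy : y ∈ ball x r
    · rw [indicator_of_mem hy]
      simp only [hf1]
      rw [abs_mul]
      apply mul_le_of_le_one_left (abs_nonneg _)
      rw [abs_of_nonneg χ.nonneg]
      exact χ.le_one
    · rw [indicator_of_notMem hy]
      have : r ≤ dist x y := not_lt.1 fun h => hy (mem_ball'.2 h)
      simp [hf1, hχ0 y this]
  have hweak := hW f1 hf1m hf1s.continuous hf1c L hL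
  have hae1 := hT f2 hf2m hf2s hf2c
  have hae2 : ∀ᵐ z : Rn n, (T (hf.toLp f) : Rn n → ℝ) z =
      (T (hf1m.toLp f1) : Rn n → ℝ) z + (T (hf2m.toLp f2) : Rn n → ℝ) z := by
    have h3 : hf.toLp f = hf1m.toLp f1 + hf2m.toLp f2 := by
      rw [← MemLp.toLp_add]
      congr 1
      ext y; simp [hf1, hf2]
    rw [h3, map_add]
    filter_upwards [Lp.coeFn_add (T (hf1m.toLp f1)) (T (hf2m.toLp f2))] with z hz
    rw [hz, Pi.add_apply]
  obtain ⟨z, hzB, hz1, hz2, hz3, hz4⟩ := good_point x r hr (T (hf.toLp f) : Rn n → ℝ)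
    (T (hf1m.toLp f1) : Rn n → ℝ) (Lp.aestronglyMeasurable _).aemeasurable γ hγ ha L
    (A * (maximal f x).toReal) hL hLa (hweak.trans (ENNReal.ofReal_le_ofReal (by
      calc A * ((∫ y, |f1 y|) / L) ≤
          A * (((maximal f x).toReal * ((volume (ball (0 : Rn n) 1)).toReal * r ^ n)) / L) := by gcongr
        _ = _ := by ring))) hLm _ (hae1.and hae2)
  have hzt : z ∉ tsupport f2 := by
    intro hz
    have hsub : tsupport f2 ⊆ (ball x (r/2))ᶜ := by
      apply closure_minimal _ isOpen_ball.isClosed_compl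
      intro y hy hyb
      exact hy (h0 y (mem_ball'.1 hyb))
    exact hsub hz (ball_subset_ball (by linarith) hzB)
  have s1 := trunc_size hθ hK f f2 hfi hf2i x r hr h0 h1 hle hm
  have s2 := trunc_reg hθ hD hK f f2 hf2i x z r hr h0 hle hm hzB
  rw [← hz3 hzt] at s2
  have s3 : |(T (hf2m.toLp f2) : Rn n → ℝ) z| ≤ 2 * L := by
    have : (T (hf2m.toLp f2) : Rn n → ℝ) z =
      (T (hf.toLp f) : Rn n → ℝ) z - (T (hf1m.toLp f1) : Rn n → ℝ) z := by linarith
    rw [this]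
    exact (abs_sub _ _).trans (by linarith)
  linarith

theorem statement12 {n : ℕ} (θ : ℝ → ℝ) (hθ : IsModulus θ) (hDini : DiniCondition θ)
    (C₀ : ℝ) (K : Rn n → Rn n → ℝ) (hK : IsThetaKernel n θ C₀ K)
    (T : Lp ℝ 2 (volume : Measure (Rn n)) →L[ℝ] Lp ℝ 2 (volume : Measure (Rn n)))
    (hT : IsCZO n K T)
    (γ : ℝ) (hγ : γ ∈ Ioc (0:ℝ) 1) :
    ∃ C : ℝ, 0 < C ∧
      ∀ (f : Rn n → ℝ) (hf : MemLp f 2 (volume : Measure (Rn n))),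
        ContDiff ℝ (⊤ : ℕ∞) f → HasCompactSupport f →
        ∀ᵐ x : Rn n,
          (⨆ j : ℤ, ENNReal.ofReal
              |∫ y in {y : Rn n | (2:ℝ) ^ j < dist x y}, K x y * f y|) ≤
            ENNReal.ofReal C *
              ((maximal (fun z => |(T (hf.toLp f) : Rn n → ℝ) z| ^ γ) x) ^ (1 / γ) +
                maximal f x) := by
  rcases Nat.eq_zero_or_pos n with hn | hn
  · subst hn
    refine ⟨1, one_pos, fun f hf _ _ => Eventually.of_forall fun x => ?_⟩
    refine iSup_le fun j => ?_
    have : {y : Rn 0 | (2:ℝ) ^ j < dist x y} = ∅ := by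
      ext y
      have h1 : dist x y = 0 := by rw [Subsingleton.elim x y, dist_self]
      have h2 : (0:ℝ) < 2 ^ j := by positivity
      constructor
      · intro h
        have h3 : (2:ℝ) ^ j < dist x y := h
        linarith
      · intro h
        exact h.elim
    rw [this]
    simp
  obtain ⟨A, hA, hW⟩ := weak_type hn hθ hDini hK hT
  have hγ0 : 0 < γ := hγ.1
  set v := (volume (ball (0 : Rn n) 1)).toReal with hv
  have hv0 : 0 ≤ v := ENNReal.toReal_nonneg
  set D := (diniSum θ).toReal with hD
  have hD0 : 0 ≤ D := ENNReal.toReal_nonneg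
  set C1 : ℝ := 2 * 4 ^ (1/γ) with hC1
  set C2 : ℝ := 2 * (4 * 4 ^ n * A) + (D * (v * 2^n) + |C₀| * 4^n * v) with hC2
  have hC10 : 0 < C1 := by positivity
  have hC20 : 0 < C2 := by positivity
  refine ⟨C1 + C2, by positivity, fun f hf hfs hfc => Eventually.of_forall fun x => ?_⟩
  have hCE : ENNReal.ofReal (C1 + C2) ≠ 0 := by
    simpa using (add_pos hC10 hC20)
  by_cases ha : maximal (fun z => |(T (hf.toLp f) : Rn n → ℝ) z| ^ γ) x = ⊤
  · rw [ha, ENNReal.top_rpow_of_pos (by positivity), top_add, ENNReal.mul_top hCE]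
    exact le_top
  by_cases hm : maximal f x = ⊤
  · rw [hm, add_top, ENNReal.mul_top hCE]
    exact le_top
  refine iSup_le fun j => ?_
  set a := maximal (fun z => |(T (hf.toLp f) : Rn n → ℝ) z| ^ γ) x with haa
  set m := maximal f x with hmm
  have ha0 : 0 ≤ a.toReal := ENNReal.toReal_nonneg
  have hm0 : 0 ≤ m.toReal := ENNReal.toReal_nonneg
  have hreal : |∫ y in {y : Rn n | (2:ℝ) ^ j < dist x y}, K x y * f y| ≤
      (C1 + C2) * (a.toReal ^ (1/γ) + m.toReal) := by
    have hp0 : 0 ≤ a.toReal ^ (1/γ) := by positivity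
    apply le_of_forall_pos_le_add
    intro ε hε
    have hq0 : 0 ≤ (4 * a.toReal) ^ (1/γ) := by positivity
    have hr0 : 0 ≤ 4 * 4 ^ n * (A * m.toReal) := by positivity
    have hcore := cotlar_core hθ hDini hK hT A hA hW γ hγ0 f hf hfs hfc x ((2:ℝ)^j) (by positivity)
      ha hm ((4 * a.toReal) ^ (1/γ) + 4 * 4 ^ n * (A * m.toReal) + ε/2) (by positivity) (by
        calc 4 * a.toReal = ((4 * a.toReal) ^ (1/γ)) ^ γ := by
              rw [← Real.rpow_mul (by positivity), one_div, inv_mul_cancel₀ hγ0.ne', Real.rpow_one]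
          _ ≤ _ := by
              apply Real.rpow_le_rpow hq0 _ hγ0.le
              linarith) (by linarith)
    refine hcore.trans ?_
    rw [Real.mul_rpow (by norm_num) ha0]
    have e : (C1 + C2) * (a.toReal ^ (1/γ) + m.toReal) =
      C1 * a.toReal ^ (1/γ) + C2 * m.toReal + (C2 * a.toReal ^ (1/γ) + C1 * m.toReal) := by ring
    have e1 : 0 ≤ C2 * a.toReal ^ (1/γ) + C1 * m.toReal := by positivity
    rw [e]
    have e2 : 2 * (4 ^ (1 / γ) * a.toReal ^ (1 / γ) + 4 * 4 ^ n * (A * m.toReal) + ε / 2) +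
        (D * (v * 2 ^ n) + |C₀| * 4 ^ n * v) * m.toReal =
        C1 * a.toReal ^ (1/γ) + C2 * m.toReal + ε := by
      simp only [hC1, hC2]; ring
    rw [e2]
    linarith
  calc _ ≤ ENNReal.ofReal ((C1 + C2) * (a.toReal ^ (1/γ) + m.toReal)) :=
        ENNReal.ofReal_le_ofReal hreal
    _ = _ := by
        rw [ENNReal.ofReal_mul (by positivity), ENNReal.ofReal_add (by positivity) hm0,
          ← ENNReal.ofReal_rpow_of_nonneg ha0 (by positivity), ENNReal.ofReal_toReal ha,
          ENNReal.ofReal_toReal hm]
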